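/- For all $q,a,z\in(0,1)$ the identity $\sum_{m,n\ge 0}\frac{q^{mn}a^m z^n}{(q;q)_m(q;q)_n}=\frac{\phi(a)\phi(z)}{\phi(az)}$ holds, with the double series converging absolutely. -/

import Mathlib

/-- The q-Pochhammer symbol `(q;q)_n = ∏_{j=1}^{n} (1 - qʲ)`. -/
noncomputable def qPochQ (q : ℝ) (n : ℕ) : ℝ := ∏ j ∈ Finset.range n, (1 - q ^ (j + 1))

/-- `φ(y) = 1/∏_{n≥0}(1 - qⁿ y)`. -/
noncomputable def phi (q y : ℝ) : ℝ := 1 / ∏' n : ℕ, (1 - q ^ n * y)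

open Filter Topology

lemma qPochQ_pos {q : ℝ} (hq0 : 0 < q) (hq1 : q < 1) (n : ℕ) : 0 < qPochQ q n :=
  Finset.prod_pos fun j _ ↦ sub_pos.2 (pow_lt_one₀ hq0.le hq1 j.succ_ne_zero)

/-- The shifted factorial `(a;q)_n = ∏_{k<n} (1 - qᵏ a)`. -/
noncomputable def qShiftedFactorial (q a : ℝ) (n : ℕ) : ℝ :=
  ∏ k ∈ Finset.range n, (1 - q ^ k * a)

lemma one_sub_pow_mul_pos {q a : ℝ} (hq0 : 0 < q) (hq1 : q < 1) (ha0 : 0 ≤ a) (ha1 : a < 1)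
    (n : ℕ) : 0 < 1 - q ^ n * a := by
  nlinarith [pow_le_one₀ (n := n) hq0.le hq1.le]

lemma qShiftedFactorial_pos {q a : ℝ} (hq0 : 0 < q) (hq1 : q < 1) (ha0 : 0 ≤ a) (ha1 : a < 1)
    (n : ℕ) : 0 < qShiftedFactorial q a n :=
  Finset.prod_pos fun k _ ↦ one_sub_pow_mul_pos hq0 hq1 ha0 ha1 k

lemma qShiftedFactorial_zero_right (q : ℝ) (n : ℕ) : qShiftedFactorial q 0 n = 1 := by
  simp [qShiftedFactorial]

lemma summable_norm_neg_pow_mul {q : ℝ} (hq0 : 0 < q) (hq1 : q < 1) (y : ℝ) :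
    Summable fun n : ℕ ↦ ‖-(q ^ n * y)‖ := by
  simpa [abs_of_pos hq0] using (summable_geometric_of_lt_one hq0.le hq1).mul_right |y|

lemma multipliable_one_sub_pow_mul {q : ℝ} (hq0 : 0 < q) (hq1 : q < 1) (y : ℝ) :
    Multipliable fun n : ℕ ↦ 1 - q ^ n * y := by
  simpa only [← sub_eq_add_neg] using
    multipliable_one_add_of_summable (summable_norm_neg_pow_mul hq0 hq1 y)

lemma tprod_one_sub_pow_mul_ne_zero {q y : ℝ} (hq0 : 0 < q) (hq1 : q < 1) (hy0 : 0 ≤ y)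
    (hy1 : y < 1) : ∏' n : ℕ, (1 - q ^ n * y) ≠ 0 := by
  simpa only [← sub_eq_add_neg] using
    tprod_one_add_ne_zero_of_summable (f := fun n : ℕ ↦ -(q ^ n * y))
      (fun n ↦ by
        simpa only [← sub_eq_add_neg] using (one_sub_pow_mul_pos hq0 hq1 hy0 hy1 n).ne')
      (summable_norm_neg_pow_mul hq0 hq1 y)

lemma phi_zero_right (q : ℝ) : phi q 0 = 1 := by
  simp [phi]

/-- `φ(qᵐ y) = (y;q)_m φ(y)`. -/
lemma phi_pow_mul {q y : ℝ} (hq0 : 0 < q) (hq1 : q < 1) (hy0 : 0 < y) (hy1 : y < 1) (m : ℕ) :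
    phi q (q ^ m * y) = qShiftedFactorial q y m * phi q y := by
  have hshift : (fun n : ℕ ↦ 1 - q ^ n * (q ^ m * y)) = fun n ↦ 1 - q ^ (n + m) * y := by
    ext n
    rw [pow_add, mul_assoc]
  have hmul := multipliable_one_sub_pow_mul hq0 hq1 (q ^ m * y)
  rw [hshift] at hmul
  have h := Multipliable.prod_mul_tprod_nat_mul' (f := fun n : ℕ ↦ 1 - q ^ n * y) hmul
  have hne := tprod_one_sub_pow_mul_ne_zero hq0 hq1 hy0.le hy1
  rw [← h] at hne
  unfold phi qShiftedFactorial
  rw [hshift, ← h]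
  rw [mul_one_div, div_mul_cancel_left₀ (left_ne_zero_of_mul hne), one_div]

lemma tendsto_qShiftedFactorial {q : ℝ} (hq0 : 0 < q) (hq1 : q < 1) (y : ℝ) :
    Tendsto (qShiftedFactorial q y) atTop (𝓝 (∏' n : ℕ, (1 - q ^ n * y))) :=
  (multipliable_one_sub_pow_mul hq0 hq1 y).tendsto_prod_tprod_nat

/-- The coefficient `(a;q)_n / (q;q)_n` of the `q`-binomial series. -/
noncomputable def qBinomialCoeff (q a : ℝ) (n : ℕ) : ℝ := qShiftedFactorial q a n / qPochQ q n

lemma qBinomialCoeff_zero (q a : ℝ) : qBinomialCoeff q a 0 = 1 := by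
  simp [qBinomialCoeff, qShiftedFactorial, qPochQ]

lemma qBinomialCoeff_pos {q a : ℝ} (hq0 : 0 < q) (hq1 : q < 1) (ha0 : 0 ≤ a) (ha1 : a < 1)
    (n : ℕ) : 0 < qBinomialCoeff q a n :=
  div_pos (qShiftedFactorial_pos hq0 hq1 ha0 ha1 n) (qPochQ_pos hq0 hq1 n)

lemma qBinomialCoeff_succ {q : ℝ} (hq0 : 0 < q) (hq1 : q < 1) (a : ℝ) (n : ℕ) :
    qBinomialCoeff q a (n + 1) * (1 - q ^ (n + 1)) = qBinomialCoeff q a n * (1 - q ^ n * a) := by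
  have h1 := (qPochQ_pos hq0 hq1 n).ne'
  have h2 : 1 - q ^ (n + 1) ≠ 0 := (sub_pos.2 (pow_lt_one₀ hq0.le hq1 n.succ_ne_zero)).ne'
  have h3 : qPochQ q (n + 1) = qPochQ q n * (1 - q ^ (n + 1)) := Finset.prod_range_succ _ _
  have h4 : qShiftedFactorial q a (n + 1) = qShiftedFactorial q a n * (1 - q ^ n * a) :=
    Finset.prod_range_succ _ _
  rw [qBinomialCoeff, qBinomialCoeff, h3, h4]
  field_simp

lemma summable_qBinomial {q a z : ℝ} (hq0 : 0 < q) (hq1 : q < 1) (ha0 : 0 ≤ a) (ha1 : a < 1)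
    (hz0 : 0 < z) (hz1 : z < 1) : Summable fun n ↦ qBinomialCoeff q a n * z ^ n := by
  have hpos n : 0 < qBinomialCoeff q a n * z ^ n :=
    mul_pos (qBinomialCoeff_pos hq0 hq1 ha0 ha1 n) (pow_pos hz0 n)
  refine summable_of_ratio_test_tendsto_lt_one hz1 (Eventually.of_forall fun n ↦ (hpos n).ne') ?_
  have hq := tendsto_pow_atTop_nhds_zero_of_lt_one hq0.le hq1
  have hlim : Tendsto (fun n : ℕ ↦ (1 - q ^ n * a) / (1 - q ^ (n + 1)) * z) atTop (𝓝 z) := by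
    simpa using (((hq.mul_const a).const_sub 1).div (((tendsto_add_atTop_iff_nat 1).2 hq).const_sub 1)
      (by norm_num)).mul_const z
  refine hlim.congr fun n ↦ ?_
  rw [Real.norm_of_nonneg (hpos _).le, Real.norm_of_nonneg (hpos _).le]
  have h1 : 1 - q ^ (n + 1) ≠ 0 := (sub_pos.2 (pow_lt_one₀ hq0.le hq1 n.succ_ne_zero)).ne'
  have h2 := (qBinomialCoeff_pos hq0 hq1 ha0 ha1 n).ne'
  rw [pow_succ z, div_mul_eq_mul_div, div_eq_div_iff h1 (hpos n).ne']
  linear_combination -(z ^ n * z) * qBinomialCoeff_succ hq0 hq1 a n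

/-- The functional equation `(1 - z) F(z) = (1 - az) F(qz)` of the `q`-binomial series. -/
lemma tsum_qBinomial_functional_eq {q a z : ℝ} (hq0 : 0 < q) (hq1 : q < 1) (ha0 : 0 ≤ a)
    (ha1 : a < 1) (hz0 : 0 < z) (hz1 : z < 1) :
    (1 - z) * ∑' n, qBinomialCoeff q a n * z ^ n =
      (1 - a * z) * ∑' n, qBinomialCoeff q a n * (q * z) ^ n := by
  have hF := summable_qBinomial hq0 hq1 ha0 ha1 hz0 hz1
  have hG := summable_qBinomial hq0 hq1 ha0 ha1 (mul_pos hq0 hz0) (by nlinarith)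
  have hdiff := (hF.sub hG).tsum_eq_zero_add
  have hstep (n : ℕ) : qBinomialCoeff q a (n + 1) * z ^ (n + 1) -
      qBinomialCoeff q a (n + 1) * (q * z) ^ (n + 1) =
      z * (qBinomialCoeff q a n * z ^ n) - a * z * (qBinomialCoeff q a n * (q * z) ^ n) := by
    rw [mul_pow, mul_pow]
    linear_combination z ^ (n + 1) * qBinomialCoeff_succ hq0 hq1 a n
  simp only [hstep, pow_zero, sub_self, zero_add] at hdiff
  rw [hF.tsum_sub hG, (hF.mul_left z).tsum_sub (hG.mul_left (a * z)), tsum_mul_left,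
    tsum_mul_left] at hdiff
  linear_combination hdiff

lemma qShiftedFactorial_mul_tsum_qBinomial {q a z : ℝ} (hq0 : 0 < q) (hq1 : q < 1) (ha0 : 0 ≤ a)
    (ha1 : a < 1) (hz0 : 0 < z) (hz1 : z < 1) (N : ℕ) :
    qShiftedFactorial q z N * ∑' n, qBinomialCoeff q a n * z ^ n =
      qShiftedFactorial q (a * z) N * ∑' n, qBinomialCoeff q a n * (q ^ N * z) ^ n := by
  induction N with
  | zero => simp [qShiftedFactorial]
  | succ N ih =>
    have hpow : q ^ N ≤ 1 := pow_le_one₀ hq0.le hq1.le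
    have h := tsum_qBinomial_functional_eq hq0 hq1 ha0 ha1 (z := q ^ N * z) (by positivity)
      (by nlinarith)
    have h3 (y : ℝ) : qShiftedFactorial q y (N + 1) = qShiftedFactorial q y N * (1 - q ^ N * y) :=
      Finset.prod_range_succ _ _
    rw [← mul_assoc q, ← pow_succ'] at h
    rw [h3, h3]
    linear_combination (1 - q ^ N * z) * ih + qShiftedFactorial q (a * z) N * h

lemma tendsto_tsum_qBinomial {q a z : ℝ} (hq0 : 0 < q) (hq1 : q < 1) (ha0 : 0 ≤ a)
    (ha1 : a < 1) (hz0 : 0 < z) (hz1 : z < 1) :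
    Tendsto (fun N : ℕ ↦ ∑' n, qBinomialCoeff q a n * (q ^ N * z) ^ n) atTop (𝓝 1) := by
  have hlim : Tendsto (fun N : ℕ ↦ q ^ N * z) atTop (𝓝 0) := by
    simpa using (tendsto_pow_atTop_nhds_zero_of_lt_one hq0.le hq1).mul_const z
  have h := tendsto_tsum_of_dominated_convergence (𝓕 := atTop)
    (f := fun (N n : ℕ) ↦ qBinomialCoeff q a n * (q ^ N * z) ^ n)
    (g := fun n ↦ qBinomialCoeff q a n * 0 ^ n)
    (summable_qBinomial hq0 hq1 ha0 ha1 hz0 hz1)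
    (fun n ↦ (hlim.pow n).const_mul _)
    (Eventually.of_forall fun N n ↦ by
      have hc := qBinomialCoeff_pos hq0 hq1 ha0 ha1 n
      rw [Real.norm_of_nonneg (by positivity)]
      gcongr
      exact mul_le_of_le_one_left hz0.le (pow_le_one₀ hq0.le hq1.le))
  rwa [tsum_eq_single 0 fun n hn ↦ by simp [hn], pow_zero, mul_one, qBinomialCoeff_zero] at h

/-- The `q`-binomial theorem `∑ (a;q)_n / (q;q)_n zⁿ = φ(z) / φ(az)`. -/
theorem hasSum_qBinomial {q a z : ℝ} (hq0 : 0 < q) (hq1 : q < 1) (ha0 : 0 ≤ a)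
    (ha1 : a < 1) (hz0 : 0 < z) (hz1 : z < 1) :
    HasSum (fun n ↦ qShiftedFactorial q a n / qPochQ q n * z ^ n)
      (phi q z / phi q (a * z)) := by
  have h := tendsto_nhds_unique
    (((tendsto_qShiftedFactorial hq0 hq1 z).mul_const _).congr
      (qShiftedFactorial_mul_tsum_qBinomial hq0 hq1 ha0 ha1 hz0 hz1))
    ((tendsto_qShiftedFactorial hq0 hq1 (a * z)).mul
      (tendsto_tsum_qBinomial hq0 hq1 ha0 ha1 hz0 hz1))
  have hne := tprod_one_sub_pow_mul_ne_zero hq0 hq1 hz0.le hz1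
  have heq : phi q z / phi q (a * z) = ∑' n, qBinomialCoeff q a n * z ^ n := by
    rw [phi, phi, div_div_eq_mul_div, div_one, one_div_mul_eq_div, div_eq_iff hne]
    linear_combination -h
  rw [heq]
  exact (summable_qBinomial hq0 hq1 ha0 ha1 hz0 hz1).hasSum

/-- Euler's identity `∑ zⁿ / (q;q)_n = φ(z)`. -/
theorem hasSum_pow_div_qPochQ {q z : ℝ} (hq0 : 0 < q) (hq1 : q < 1) (hz0 : 0 < z) (hz1 : z < 1) :
    HasSum (fun n ↦ z ^ n / qPochQ q n) (phi q z) := by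
  simpa [qShiftedFactorial_zero_right, phi_zero_right, div_eq_inv_mul] using
    hasSum_qBinomial hq0 hq1 le_rfl one_pos hz0 hz1

/-- For `q, a, z ∈ (0,1)`:
`∑_{m,n≥0} q^{mn} aᵐ zⁿ / ((q;q)_m (q;q)_n) = φ(a)φ(z)/φ(az)`, the double series
converging absolutely. -/
theorem double_sum_eq_phi_ratio (q a z : ℝ) (hq : q ∈ Set.Ioo (0 : ℝ) 1)
    (ha : a ∈ Set.Ioo (0 : ℝ) 1) (hz : z ∈ Set.Ioo (0 : ℝ) 1) :
    (Summable fun p : ℕ × ℕ =>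
      |q ^ (p.1 * p.2) * a ^ p.1 * z ^ p.2 / (qPochQ q p.1 * qPochQ q p.2)|) ∧
      (∑' p : ℕ × ℕ, q ^ (p.1 * p.2) * a ^ p.1 * z ^ p.2 / (qPochQ q p.1 * qPochQ q p.2)) =
        phi q a * phi q z / phi q (a * z) := by
  obtain ⟨hq0, hq1⟩ := hq
  obtain ⟨ha0, ha1⟩ := ha
  obtain ⟨hz0, hz1⟩ := hz
  have hnonneg : ∀ p : ℕ × ℕ,
      0 ≤ q ^ (p.1 * p.2) * a ^ p.1 * z ^ p.2 / (qPochQ q p.1 * qPochQ q p.2) := fun p ↦ by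
    have := qPochQ_pos hq0 hq1 p.1
    have := qPochQ_pos hq0 hq1 p.2
    positivity
  have hrow : ∀ m : ℕ, HasSum
      (fun n ↦ q ^ (m * n) * a ^ m * z ^ n / (qPochQ q m * qPochQ q n))
      (phi q z * (qShiftedFactorial q z m / qPochQ q m * a ^ m)) := fun m ↦ by
    have hpow : q ^ m ≤ 1 := pow_le_one₀ hq0.le hq1.le
    have h := (hasSum_pow_div_qPochQ hq0 hq1 (z := q ^ m * z) (by positivity)
      (by nlinarith)).mul_left (a ^ m / qPochQ q m)
    rw [phi_pow_mul hq0 hq1 hz0 hz1] at h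
    have hterm (n : ℕ) : q ^ (m * n) * a ^ m * z ^ n / (qPochQ q m * qPochQ q n) =
        a ^ m / qPochQ q m * ((q ^ m * z) ^ n / qPochQ q n) := by
      rw [mul_pow, ← pow_mul]
      ring
    have hval : phi q z * (qShiftedFactorial q z m / qPochQ q m * a ^ m) =
        a ^ m / qPochQ q m * (qShiftedFactorial q z m * phi q z) := by
      ring
    simpa only [hterm, hval] using h
  have hsum := (hasSum_qBinomial hq0 hq1 hz0.le hz1 ha0 ha1).mul_left (phi q z)
  have hs : Summable fun p : ℕ × ℕ =>
      q ^ (p.1 * p.2) * a ^ p.1 * z ^ p.2 / (qPochQ q p.1 * qPochQ q p.2) := by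
    refine (summable_prod_of_nonneg hnonneg).2 ⟨fun m ↦ (hrow m).summable, ?_⟩
    simpa only [(hrow _).tsum_eq] using hsum.summable
  refine ⟨hs.abs, ?_⟩
  rw [(hs.hasSum.prod_fiberwise hrow).unique hsum, mul_comm a z]
  ring
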